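/- arXiv:1105.1229 — 2 statements merged into one kernel-verified Lean document; each statement's English description precedes it below -/
import Mathlib

section
/- Let B = {m₁,…,m_r} and B' = {m'₁,…,m'_r} be two sets of r monomials in R = K[x₁,…,xₙ], each connected to 1, and let Λ be a K-linear functional defined on the linear span of all products b'·b with b' ∈ B'⁺ and b ∈ B⁺. Then there exists a K-linear functional Λ̃ on all of R agreeing with Λ on span(B'⁺·B⁺), such that the Hankel operator H_Λ̃ has rank r and the classes of B and of B' are each bases of R/I_Λ̃, if and only if the matrix (Λ(b'·b))_{b'∈B'⁺, b∈B⁺} has rank exactly r (i.e. all its (r+1)×(r+1) minors vanish) and the r×r submatrix (Λ(m'_i·m_j))_{1≤i,j≤r} is invertible. -/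
open MvPolynomial

/-- The Hankel operator `H_Λ : R →ₗ[K] R*`, `p ↦ (q ↦ Λ(p·q))`. -/
noncomputable def hankel {K : Type*} [Field K] {n : ℕ}
    (Λ : MvPolynomial (Fin n) K →ₗ[K] K) :
    MvPolynomial (Fin n) K →ₗ[K] (MvPolynomial (Fin n) K →ₗ[K] K) :=
  (LinearMap.llcomp K (MvPolynomial (Fin n) K) (MvPolynomial (Fin n) K) K Λ).comp
    (LinearMap.mul K (MvPolynomial (Fin n) K))

/-- The kernel `I_Λ = {p : ∀ q, Λ(p·q) = 0}` of the Hankel operator, as an ideal of R. -/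
noncomputable def hankelIdeal {K : Type*} [Field K] {n : ℕ}
    (Λ : MvPolynomial (Fin n) K →ₗ[K] K) : Ideal (MvPolynomial (Fin n) K) where
  carrier := {p | ∀ q, Λ (p * q) = 0}
  add_mem' := by
    intro a b ha hb q
    simp [add_mul, map_add, ha q, hb q]
  zero_mem' := by intro q; simp
  smul_mem' := by
    intro c p hp q
    have := hp (c * q)
    simpa [smul_eq_mul, mul_assoc, mul_comm, mul_left_comm] using this

/-- A family of monomials (given by exponent vectors) is connected to 1 if every
member is either 1 or of the form xₗ·m' for some variable xₗ and member m'. -/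
def ConnectedToOne {n r : ℕ} (α : Fin r → (Fin n →₀ ℕ)) : Prop :=
  ∀ i, α i = 0 ∨ ∃ (l : Fin n) (i' : Fin r), α i = Finsupp.single l 1 + α i'

/-- An enumeration of B⁺ = B ∪ x₁B ∪ ⋯ ∪ xₙB for the family of monomials with
exponents `α`: the index `(none, i)` gives mᵢ and `(some l, i)` gives xₗ·mᵢ. -/
noncomputable def bPlus {K : Type*} [Field K] {n r : ℕ} (α : Fin r → (Fin n →₀ ℕ)) :
    Option (Fin n) × Fin r → MvPolynomial (Fin n) K :=
  fun p => p.1.elim 1 X * monomial (α p.2) 1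


theorem exists_aeval_of_comm {K A : Type*} [Field K] [Ring A] [Algebra K A] {n : ℕ} (T : Fin n → A)
    (hT : ∀ k l, T k * T l = T l * T k) :
    ∃ φ : MvPolynomial (Fin n) K →ₐ[K] A, ∀ l, φ (X l) = T l := by
  have hc : ∀ a ∈ Set.range T, ∀ b ∈ Set.range T, a * b = b * a := by
    rintro _ ⟨k, rfl⟩ _ ⟨l, rfl⟩; exact hT k l
  let _ := Algebra.adjoinCommRingOfComm K hc
  refine ⟨(Algebra.adjoin K (Set.range T)).val.comp
    (aeval (fun l => (⟨T l, Algebra.subset_adjoin ⟨l, rfl⟩⟩ : Algebra.adjoin K (Set.range T)))), ?_⟩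
  intro l
  simp

/-- linear combinations of the monomials with exponents `α` -/
noncomputable def lc (K : Type*) [Field K] {n r : ℕ} (α : Fin r → (Fin n →₀ ℕ)) :
    (Fin r → K) →ₗ[K] MvPolynomial (Fin n) K :=
  Fintype.linearCombination K (fun j => monomial (α j) (1 : K))

section
variable {K : Type*} [Field K] {n r : ℕ} (α α' : Fin r → (Fin n →₀ ℕ))

theorem lc_apply (v : Fin r → K) : lc K α v = ∑ j, v j • monomial (α j) (1 : K) := rfl

theorem lc_single (j : Fin r) : lc K α (Pi.single j 1) = monomial (α j) 1 := by
  simp [lc]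

theorem mk_lc (I : Ideal (MvPolynomial (Fin n) K)) (v : Fin r → K) :
    Ideal.Quotient.mk I (lc K α v) =
      ∑ j, v j • Ideal.Quotient.mk I (monomial (α j) (1 : K)) := by
  rw [lc_apply, map_sum]
  exact Finset.sum_congr rfl fun j _ => map_smul (Ideal.Quotient.mkₐ K I) _ _

theorem li_iff (I : Ideal (MvPolynomial (Fin n) K)) :
    LinearIndependent K (fun i => Ideal.Quotient.mk I (monomial (α i) (1 : K))) ↔
      ∀ v, lc K α v ∈ I → v = 0 := by
  rw [Fintype.linearIndependent_iff]
  refine forall_congr' fun v => ?_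
  rw [← mk_lc, Ideal.Quotient.eq_zero_iff_mem, funext_iff]
  rfl

theorem span_iff (I : Ideal (MvPolynomial (Fin n) K)) :
    Submodule.span K (Set.range fun i => Ideal.Quotient.mk I (monomial (α i) (1 : K))) = ⊤ ↔
      ∀ p, ∃ c, p - lc K α c ∈ I := by
  rw [Submodule.eq_top_iff']
  have key : ∀ p, Ideal.Quotient.mk I p ∈ Submodule.span K
      (Set.range fun i => Ideal.Quotient.mk I (monomial (α i) (1 : K))) ↔
        ∃ c, p - lc K α c ∈ I := by
    intro p
    rw [Submodule.mem_span_range_iff_exists_fun]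
    refine exists_congr fun c => ?_
    rw [← mk_lc, ← Ideal.Quotient.eq, eq_comm]
  constructor
  · intro h p; exact (key p).1 (h _)
  · intro h x
    obtain ⟨p, rfl⟩ := Ideal.Quotient.mk_surjective x
    exact (key p).2 (h p)

theorem mem_hI (L : MvPolynomial (Fin n) K →ₗ[K] K) (p : MvPolynomial (Fin n) K) :
    p ∈ hankelIdeal L ↔ ∀ q, L (p * q) = 0 := Iff.rfl

theorem eq_zero_of_mem (L : MvPolynomial (Fin n) K →ₗ[K] K) {p : MvPolynomial (Fin n) K}
    (h : p ∈ hankelIdeal L) : L p = 0 := by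
  simpa using h 1

theorem lc_mul_zero (L : MvPolynomial (Fin n) K →ₗ[K] K) (g : MvPolynomial (Fin n) K)
    (h : ∀ i, L (monomial (α i) 1 * g) = 0) (c : Fin r → K) : L (lc K α c * g) = 0 := by
  rw [lc_apply, Finset.sum_mul, map_sum]
  refine Finset.sum_eq_zero fun i _ => ?_
  rw [smul_mul_assoc, map_smul, h, smul_zero]

theorem mem_of_span (L : MvPolynomial (Fin n) K →ₗ[K] K)
    (hs : ∀ p, ∃ c, p - lc K α c ∈ hankelIdeal L) (g : MvPolynomial (Fin n) K)
    (h : ∀ i, L (monomial (α i) 1 * g) = 0) : g ∈ hankelIdeal L := by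
  intro q
  obtain ⟨c, hc⟩ := hs q
  have h1 := hc g
  rw [sub_mul, map_sub, lc_mul_zero α L g h, sub_zero] at h1
  rw [mul_comm, h1]

theorem bPlus_none (i : Fin r) : bPlus (K := K) α (none, i) = monomial (α i) 1 := by
  simp [bPlus]

theorem bPlus_some (l : Fin n) (i : Fin r) :
    bPlus (K := K) α (some l, i) = X l * monomial (α i) 1 := by
  simp [bPlus]

theorem mul_lc (L : MvPolynomial (Fin n) K →ₗ[K] K) (p : MvPolynomial (Fin n) K)
    (v : Fin r → K) : L (p * lc K α v) = ∑ j, L (p * monomial (α j) 1) * v j := by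
  rw [lc_apply, Finset.mul_sum, map_sum]
  refine Finset.sum_congr rfl fun j _ => ?_
  rw [mul_smul_comm, map_smul, smul_eq_mul, mul_comm]

theorem isUnit_iff_nondeg (L : MvPolynomial (Fin n) K →ₗ[K] K) :
    IsUnit ((Matrix.of fun i j => L (monomial (α' i) (1 : K) * monomial (α j) 1)) :
        Matrix (Fin r) (Fin r) K) ↔
      ∀ v, (∀ i, L (monomial (α' i) 1 * lc K α v) = 0) → v = 0 := by
  rw [← Matrix.mulVec_injective_iff_isUnit, ← Matrix.coe_mulVecLin, injective_iff_map_eq_zero]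
  refine forall_congr' fun v => ?_
  rw [funext_iff]
  simp only [mul_lc, Matrix.mulVecLin_apply, Matrix.mulVec, dotProduct, Matrix.of_apply,
    Pi.zero_apply]

theorem isUnit_swap (L : MvPolynomial (Fin n) K →ₗ[K] K)
    (h : IsUnit ((Matrix.of fun i j => L (monomial (α' i) (1 : K) * monomial (α j) 1)) :
        Matrix (Fin r) (Fin r) K)) :
    IsUnit ((Matrix.of fun i j => L (monomial (α i) (1 : K) * monomial (α' j) 1)) :
        Matrix (Fin r) (Fin r) K) := by
  have := (Matrix.isUnit_transpose _).2 h
  convert this using 1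
  ext i j
  simp [mul_comm]

theorem conn_ind (hc : ConnectedToOne α) (P : Fin r → Prop) (h0 : ∀ i, α i = 0 → P i)
    (h1 : ∀ i l j, α i = Finsupp.single l 1 + α j → P j → P i) : ∀ i, P i := by
  have : ∀ d i, (α i).degree = d → P i := by
    intro d
    induction d with
    | zero => intro i hi; exact h0 i ((Finsupp.degree_eq_zero_iff _).1 hi)
    | succ d ih =>
      intro i hi
      rcases hc i with h | ⟨l, j, h⟩
      · exact h0 i h
      · refine h1 i l j h (ih j ?_)
        rw [h, map_add, Finsupp.degree_single] at hi
        omega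
  exact fun i => this _ i rfl

theorem conn_zero (hc : ConnectedToOne α) (i : Fin r) : ∃ j, α j = 0 :=
  conn_ind α hc (fun _ => ∃ j, α j = 0) (fun i h => ⟨i, h⟩) (fun _ _ _ _ h => h) i

theorem mon_zero : monomial (0 : Fin n →₀ ℕ) (1 : K) = 1 := rfl

theorem mon_succ (l : Fin n) (a : Fin n →₀ ℕ) :
    monomial (Finsupp.single l 1 + a) (1 : K) = X l * monomial a 1 := by
  rw [X, monomial_mul, one_mul]

theorem exists_mulOp (L : MvPolynomial (Fin n) K →ₗ[K] K)
    (hM : ((Matrix.of fun p q => L (bPlus α' p * bPlus α q)) :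
        Matrix (Option (Fin n) × Fin r) (Option (Fin n) × Fin r) K).rank = r)
    (hA : IsUnit ((Matrix.of fun i j => L (monomial (α' i) (1 : K) * monomial (α j) 1)) :
        Matrix (Fin r) (Fin r) K)) :
    ∃ T : Fin n → Module.End K (Fin r → K), ∀ l v p,
      L (bPlus α' p * lc K α (T l v)) = L (bPlus α' p * (X l * lc K α v)) := by
  set M := ((Matrix.of fun p q => L (bPlus α' p * bPlus α q)) :
        Matrix (Option (Fin n) × Fin r) (Option (Fin n) × Fin r) K) with hMdef
  let P := M.submatrix id (fun j : Fin r => ((none : Option (Fin n)), j))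
  have hPr : r ≤ P.rank := by
    have h1 := P.rank_submatrix_le (fun i : Fin r => ((none : Option (Fin n)), i)) id
    have h2 := Matrix.rank_of_isUnit _ hA
    rw [Fintype.card_fin] at h2
    refine h2.symm.le.trans (le_trans (le_of_eq ?_) h1)
    congr 1
    ext i j
    simp [P, M, bPlus_none]
  have hcolP : ∀ j, P.col j = M.col (none, j) := fun j => rfl
  have hle : LinearMap.range P.mulVecLin ≤ LinearMap.range M.mulVecLin := by
    rw [Matrix.range_mulVecLin, Matrix.range_mulVecLin, Submodule.span_le]
    rintro _ ⟨j, rfl⟩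
    exact Submodule.subset_span ⟨(none, j), rfl⟩
  have heq : LinearMap.range P.mulVecLin = LinearMap.range M.mulVecLin :=
    Submodule.eq_of_le_of_finrank_le hle (by
      change M.rank ≤ P.rank
      omega)
  have hC : ∀ q, ∃ c : Fin r → K, P.mulVec c = M.col q := by
    intro q
    have : M.col q ∈ LinearMap.range P.mulVecLin := by
      rw [heq, Matrix.range_mulVecLin]; exact Submodule.subset_span ⟨q, rfl⟩
    exact this
  choose C hC using hC
  have hC' : ∀ p q, L (bPlus α' p * lc K α (C q)) = L (bPlus α' p * bPlus α q) := by
    intro p q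
    have := congrFun (hC q) p
    rw [mul_lc]
    simpa [Matrix.mulVec, dotProduct, P, M, bPlus_none] using this
  refine ⟨fun l => Fintype.linearCombination K (fun j => C (some l, j)), fun l v p => ?_⟩
  rw [Fintype.linearCombination_apply, map_sum, Finset.mul_sum, map_sum, ← mul_assoc, mul_lc]
  refine Finset.sum_congr rfl fun j _ => ?_
  rw [map_smul, mul_smul_comm, map_smul, hC', bPlus_some, smul_eq_mul, mul_comm, mul_assoc]

theorem backward [NeZero r] (hcα : ConnectedToOne α) (hcα' : ConnectedToOne α')
    (L : MvPolynomial (Fin n) K →ₗ[K] K)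
    (hM : ((Matrix.of fun p q => L (bPlus α' p * bPlus α q)) :
        Matrix (Option (Fin n) × Fin r) (Option (Fin n) × Fin r) K).rank = r)
    (hA : IsUnit ((Matrix.of fun i j => L (monomial (α' i) (1 : K) * monomial (α j) 1)) :
        Matrix (Fin r) (Fin r) K)) :
    ∃ (N : MvPolynomial (Fin n) K →ₗ[K] (Fin r → K)) (Lt : MvPolynomial (Fin n) K →ₗ[K] K),
      (∀ p q, Lt (bPlus α' p * bPlus α q) = L (bPlus α' p * bPlus α q)) ∧
      (∀ p, p ∈ hankelIdeal Lt ↔ N p = 0) ∧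
      (∀ v, N (lc K α v) = v) ∧
      (∀ L2 : MvPolynomial (Fin n) K →ₗ[K] K,
        (∀ p q, L2 (bPlus α' p * bPlus α q) = L (bPlus α' p * bPlus α q)) →
        (∀ p, ∃ c, p - lc K α' c ∈ hankelIdeal L2) → L2 = Lt) := by
  obtain ⟨T, hT⟩ := exists_mulOp α α' L hM hA
  have nd := (isUnit_iff_nondeg α α' L).1 hA
  have nd' : ∀ v w, (∀ i, L (monomial (α' i) 1 * lc K α v) = L (monomial (α' i) 1 * lc K α w)) →
      v = w := by
    intro v w h
    rw [← sub_eq_zero]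
    refine nd _ fun i => ?_
    rw [map_sub, mul_sub, map_sub, h, sub_self]
  have hT0 : ∀ l v i, L (monomial (α' i) 1 * lc K α (T l v)) =
      L (monomial (α' i) 1 * (X l * lc K α v)) := by
    intro l v i
    simpa [bPlus_none] using hT l v (none, i)
  have hT1 : ∀ k l v i, L (X k * monomial (α' i) 1 * lc K α (T l v)) =
      L (X k * monomial (α' i) 1 * (X l * lc K α v)) := by
    intro k l v i
    simpa [bPlus_some] using hT l v (some k, i)
  have hTT : ∀ k l v i, L (monomial (α' i) 1 * lc K α (T k (T l v))) =
      L (monomial (α' i) 1 * (X k * (X l * lc K α v))) := by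
    intro k l v i
    rw [hT0, ← mul_assoc, mul_comm _ (X k), hT1, mul_comm (X k), mul_assoc]
  have comm : ∀ k l, T k * T l = T l * T k := by
    intro k l
    refine LinearMap.ext fun v => nd' _ _ fun i => ?_
    rw [Module.End.mul_apply, Module.End.mul_apply, hTT, hTT, mul_left_comm (X k)]
  obtain ⟨φ, hφ⟩ := exists_aeval_of_comm (K := K) T comm
  obtain ⟨i0, hi0⟩ := conn_zero α hcα 0
  obtain ⟨i0', hi0'⟩ := conn_zero α' hcα' 0
  let e : Fin r → K := Pi.single i0 1
  have he : lc K α e = 1 := by simp only [e]; rw [lc_single, hi0]; rfl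
  let N : MvPolynomial (Fin n) K →ₗ[K] (Fin r → K) := (LinearMap.applyₗ e).comp φ.toLinearMap
  have hN : ∀ p, N p = φ p e := fun p => rfl
  have hNmul : ∀ p q, N (p * q) = φ p (N q) := by
    intro p q; rw [hN, hN, map_mul, Module.End.mul_apply]
  have hNX : ∀ l q, N (X l * q) = T l (N q) := by
    intro l q; rw [hNmul, hφ]
  have hNb : ∀ j, N (monomial (α j) 1) = Pi.single j 1 := by
    refine conn_ind α hcα _ ?_ ?_
    · intro i hi
      refine nd' _ _ fun k => ?_
      rw [lc_single, hi, hN, mon_zero, map_one φ, Module.End.one_apply, he]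
    · intro i l j hij hj
      refine nd' _ _ fun k => ?_
      rw [lc_single, hij, mon_succ, hNX, hj, hT0, lc_single]
  have hNlc : ∀ v, N (lc K α v) = v := by
    intro v
    rw [lc_apply, map_sum]
    simp only [map_smul, hNb]
    exact (pi_eq_sum_univ' v).symm
  have hB' : ∀ i v, L (lc K α (φ (monomial (α' i) 1) v)) = L (monomial (α' i) 1 * lc K α v) := by
    refine conn_ind α' hcα' _ ?_ ?_
    · intro i hi v
      rw [hi, mon_zero, map_one φ, Module.End.one_apply, one_mul]
    · intro i l j hij hj v
      rw [hij, mon_succ, mul_comm, map_mul, Module.End.mul_apply, hj, hφ, hT0, mul_assoc]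
  have hB'X : ∀ l i v, L (lc K α (φ (X l * monomial (α' i) 1) v)) =
      L (X l * monomial (α' i) 1 * lc K α v) := by
    intro l i v
    rw [mul_comm, map_mul, Module.End.mul_apply, hB', hφ, hT0, mul_assoc]
  let Lt : MvPolynomial (Fin n) K →ₗ[K] K := (L.comp (lc K α)).comp N
  have hLt : ∀ p, Lt p = L (lc K α (N p)) := fun p => rfl
  have hB'p : ∀ p q, Lt (bPlus α' p * q) = L (bPlus α' p * lc K α (N q)) := by
    rintro ⟨_ | l, i⟩ q
    · rw [bPlus_none, hLt, hNmul, hB']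
    · rw [bPlus_some, hLt, hNmul, hB'X]
  refine ⟨N, Lt, ?_, ?_, hNlc, ?_⟩
  · rintro p ⟨_ | l, j⟩
    · rw [hB'p, bPlus_none, hNb, lc_single]
    · rw [hB'p, bPlus_some, hNX, hNb, hT, lc_single]
  · intro p
    constructor
    · intro hp
      refine nd _ fun i => ?_
      rw [← bPlus_none, ← hB'p, mul_comm]
      exact hp _
    · intro hp q
      rw [mul_comm, hLt, hNmul, hp, map_zero, map_zero, map_zero]
  · intro L2 h2 hs
    have hlc : ∀ p v, L2 (bPlus α' p * lc K α v) = L (bPlus α' p * lc K α v) := by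
      intro p v
      rw [mul_lc, mul_lc]
      refine Finset.sum_congr rfl fun j _ => ?_
      rw [← bPlus_none, h2]
    have hg : ∀ l v, X l * lc K α v - lc K α (T l v) ∈ hankelIdeal L2 := by
      intro l v
      refine mem_of_span α' L2 hs _ fun i => ?_
      have h3 := hlc (some l, i) v
      have h4 := hlc (none, i) (T l v)
      rw [bPlus_some] at h3
      rw [bPlus_none] at h4
      rw [mul_sub, map_sub, h4, hT0, ← mul_assoc, mul_comm _ (X l), h3, sub_self]
    have hall : ∀ p, p - lc K α (N p) ∈ hankelIdeal L2 := by
      intro p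
      induction p using MvPolynomial.induction_on with
      | C a =>
        have : (C a : MvPolynomial (Fin n) K) = a • lc K α e := by
          rw [he, smul_eq_C_mul, mul_one]
        rw [this, map_smul, hNlc, map_smul, sub_self]
        exact zero_mem _
      | add p q hp hq =>
        rw [map_add, map_add, add_sub_add_comm]
        exact add_mem hp hq
      | mul_X p l hp =>
        have h5 := add_mem (Ideal.mul_mem_left _ (X l) hp) (hg l (N p))
        rw [mul_comm p, hNX]
        convert h5 using 1
        ring
    refine LinearMap.ext fun p => ?_
    have h6 := eq_zero_of_mem L2 (hall p)
    rw [map_sub, sub_eq_zero] at h6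
    have h7 := hlc (none, i0') (N p)
    rw [bPlus_none, hi0', mon_zero, one_mul] at h7
    rw [h6, h7, hLt]

theorem hankel_ker (L : MvPolynomial (Fin n) K →ₗ[K] K) (p : MvPolynomial (Fin n) K) :
    p ∈ LinearMap.ker (hankel L) ↔ p ∈ hankelIdeal L := by
  rw [LinearMap.mem_ker, mem_hI, LinearMap.ext_iff]
  rfl

end

/-- flat-extension criterion via rank: Λ (given by its values on
span(B'⁺·B⁺)) admits a unique extension Λ̃ to R with rank H_Λ̃ = r and the classes
of B, B' bases of R/I_Λ̃, iff the matrix (Λ(b'·b))_{b'∈B'⁺, b∈B⁺} has rank exactly r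
and the r×r submatrix (Λ(m'ᵢ·mⱼ)) is invertible. -/
theorem flat_extension_rank_criterion {K : Type*} [Field K] {n r : ℕ}
    (α α' : Fin r → (Fin n →₀ ℕ))
    (hα : Function.Injective α) (hα' : Function.Injective α')
    (hcα : ConnectedToOne α) (hcα' : ConnectedToOne α')
    (Λ : MvPolynomial (Fin n) K →ₗ[K] K) :
    (∃! Λt : MvPolynomial (Fin n) K →ₗ[K] K,
      (∀ (p q : Option (Fin n) × Fin r),
        Λt (bPlus α' p * bPlus α q) = Λ (bPlus α' p * bPlus α q)) ∧
      Module.Finite K (LinearMap.range (hankel Λt)) ∧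
      Module.finrank K (LinearMap.range (hankel Λt)) = r ∧
      (LinearIndependent K
          (fun i => Ideal.Quotient.mk (hankelIdeal Λt) (monomial (α i) (1 : K))) ∧
        Submodule.span K
          (Set.range fun i =>
            Ideal.Quotient.mk (hankelIdeal Λt) (monomial (α i) (1 : K))) = ⊤) ∧
      (LinearIndependent K
          (fun i => Ideal.Quotient.mk (hankelIdeal Λt) (monomial (α' i) (1 : K))) ∧
        Submodule.span K
          (Set.range fun i =>
            Ideal.Quotient.mk (hankelIdeal Λt) (monomial (α' i) (1 : K))) = ⊤))
    ↔
    (((Matrix.of fun p q => Λ (bPlus α' p * bPlus α q)) :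
        Matrix (Option (Fin n) × Fin r) (Option (Fin n) × Fin r) K).rank = r ∧
     IsUnit ((Matrix.of fun i j =>
        Λ (monomial (α' i) (1 : K) * monomial (α j) 1)) :
        Matrix (Fin r) (Fin r) K)) := by
  simp only [li_iff, span_iff]
  constructor
  · rintro ⟨Lt, ⟨hag, -, -, ⟨hli, hsp⟩, hli', hsp'⟩, -⟩
    have hM : ((Matrix.of fun p q => Λ (bPlus α' p * bPlus α q)) :
        Matrix (Option (Fin n) × Fin r) (Option (Fin n) × Fin r) K) =
        Matrix.of fun p q => Lt (bPlus α' p * bPlus α q) := by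
      ext p q; exact (hag p q).symm
    have hA : ((Matrix.of fun i j => Λ (monomial (α' i) (1 : K) * monomial (α j) 1)) :
        Matrix (Fin r) (Fin r) K) =
        Matrix.of fun i j => Lt (monomial (α' i) (1 : K) * monomial (α j) 1) := by
      ext i j
      simpa [bPlus_none] using (hag (none, i) (none, j)).symm
    rw [hM, hA]
    have hu := (isUnit_iff_nondeg α α' Lt).2 fun v hv => hli v (mem_of_span α' Lt hsp' _ hv)
    refine ⟨le_antisymm ?_ ?_, hu⟩
    · choose c hc using fun q => hsp (bPlus α q)
      have : ((Matrix.of fun p q => Lt (bPlus α' p * bPlus α q)) :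
        Matrix (Option (Fin n) × Fin r) (Option (Fin n) × Fin r) K) =
        (Matrix.of fun p j => Lt (bPlus α' p * monomial (α j) 1)) *
          (Matrix.of fun j q => c q j : Matrix (Fin r) _ K) := by
        ext p q
        have h1 := hc q (bPlus α' p)
        rw [mul_comm, mul_sub, map_sub, sub_eq_zero, mul_lc] at h1
        simpa [Matrix.mul_apply] using h1
      rw [this]
      refine (Matrix.rank_mul_le_left _ _).trans ?_
      simpa using Matrix.rank_le_card_width
        (Matrix.of fun p j => Lt (bPlus α' p * monomial (α j) 1) : Matrix _ (Fin r) K)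
    · have h1 := Matrix.rank_submatrix_le ((Matrix.of fun p q => Lt (bPlus α' p * bPlus α q)) :
        Matrix (Option (Fin n) × Fin r) (Option (Fin n) × Fin r) K)
        (fun i : Fin r => (none, i)) (fun i : Fin r => (none, i))
      have h2 := Matrix.rank_of_isUnit _ hu
      rw [Fintype.card_fin] at h2
      refine h2.symm.le.trans (le_trans (le_of_eq ?_) h1)
      congr 1
      ext i j
      simp [bPlus_none]
  · rintro ⟨hM, hA⟩
    rcases Nat.eq_zero_or_pos r with rfl | hr
    · have hall : ∀ p, p ∈ hankelIdeal (0 : MvPolynomial (Fin n) K →ₗ[K] K) := fun p q => rfl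
      have hr0 : LinearMap.range (hankel (0 : MvPolynomial (Fin n) K →ₗ[K] K)) = ⊥ := by
        rw [LinearMap.range_eq_bot]
        ext1; rfl
      refine ⟨0, ⟨fun p => p.2.elim0, ?_, ?_, ⟨fun v _ => Subsingleton.elim _ _, fun p => ⟨0, hall _⟩⟩,
        fun v _ => Subsingleton.elim _ _, fun p => ⟨0, hall _⟩⟩, ?_⟩
      · rw [hr0]; infer_instance
      · rw [hr0]; simp
      · rintro L2 ⟨-, -, -, ⟨-, hs⟩, -⟩
        refine LinearMap.ext fun p => ?_
        obtain ⟨c, hc⟩ := hs p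
        have h1 := eq_zero_of_mem L2 hc
        have hc0 : c = 0 := Subsingleton.elim _ _
        rw [hc0, map_zero, sub_zero] at h1
        exact h1
    · have : NeZero r := ⟨hr.ne'⟩
      obtain ⟨N, Lt, hag, hI, hNlc, huniq⟩ := backward α α' hcα hcα' Λ hM hA
      have hsurj : Function.Surjective N := fun v => ⟨_, hNlc v⟩
      have hker : LinearMap.ker (hankel Lt) = LinearMap.ker N := by
        ext p
        rw [hankel_ker, hI, LinearMap.mem_ker]
      let eqv : LinearMap.range (hankel Lt) ≃ₗ[K] (Fin r → K) :=
        (hankel Lt).quotKerEquivRange.symm.trans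
          ((Submodule.quotEquivOfEq _ _ hker).trans (N.quotKerEquivOfSurjective hsurj))
      have hA2 : IsUnit ((Matrix.of fun i j =>
          Lt (monomial (α' i) (1 : K) * monomial (α j) 1)) : Matrix (Fin r) (Fin r) K) := by
        convert hA using 1
        ext i j
        simpa [bPlus_none] using (hag (none, i) (none, j))
      have nd2 := (isUnit_iff_nondeg α' α Lt).1 (isUnit_swap α α' Lt hA2)
      have hli' : ∀ v, lc K α' v ∈ hankelIdeal Lt → v = 0 := by
        intro v hv
        refine nd2 v fun i => ?_
        rw [mul_comm]
        exact hv _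
      have hinj : Function.Injective (N.comp (lc K α')) := by
        rw [injective_iff_map_eq_zero]
        intro v hv
        exact hli' v ((hI _).2 hv)
      have hsurj' := LinearMap.injective_iff_surjective.1 hinj
      refine ⟨Lt, ⟨hag, Module.Finite.equiv eqv.symm, ?_, ⟨?_, ?_⟩, hli', ?_⟩, ?_⟩
      · rw [eqv.finrank_eq]; simp
      · intro v hv
        rw [hI, hNlc] at hv
        exact hv
      · intro p
        refine ⟨N p, ?_⟩
        rw [hI, map_sub, hNlc, sub_self]
      · intro p
        obtain ⟨c, hc⟩ := hsurj' (N p)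
        refine ⟨c, ?_⟩
        rw [hI, map_sub, sub_eq_zero]
        exact hc.symm
      · rintro L2 ⟨h2, -, -, -, -, hs⟩
        exact huniq L2 h2 hs
end

section
/- Let K be an algebraically closed field of characteristic 0, R = K[x₁,…,xₙ], d ∈ ℕ, and let T* be a K-linear functional on the subspace R_{≤d} of polynomials of degree at most d. Then there exist r distinct points ζ₁,…,ζ_r ∈ Kⁿ and nonzero scalars γ₁,…,γ_r ∈ K with T*(p) = Σ_{i=1}^r γ_i·p(ζ_i) for all p ∈ R_{≤d}, if and only if there exists a K-linear functional Λ on all of R whose restriction to R_{≤d} equals T*, such that the Hankel operator H_Λ has rank r and I_Λ is a radical ideal. -/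
open MvPolynomial

theorem aux_interp {K : Type*} [Field K] {n : ℕ} {ι : Type*} [Fintype ι] [DecidableEq ι]
    (ζ : ι → (Fin n → K)) (hζ : Function.Injective ζ) :
    ∃ p : ι → MvPolynomial (Fin n) K, ∀ i j, eval (ζ j) (p i) = if i = j then 1 else 0 := by
  have h : ∀ i j, ∃ q : MvPolynomial (Fin n) K,
      i ≠ j → eval (ζ i) q = 1 ∧ eval (ζ j) q = 0 := by
    intro i j
    by_cases hij : i = j
    · exact ⟨0, fun h => absurd hij h⟩
    · have : ∃ k, ζ i k ≠ ζ j k := by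
        by_contra! hc
        exact hij (hζ (funext hc))
      obtain ⟨k, hk⟩ := this
      have hk' := sub_ne_zero.mpr hk
      refine ⟨C ((ζ i k - ζ j k)⁻¹) * (X k - C (ζ j k)), fun _ => ⟨?_, ?_⟩⟩
      · simp [hk']
      · simp
  choose q hq using h
  refine ⟨fun i => ∏ j ∈ Finset.univ.erase i, q i j, fun i j => ?_⟩
  rw [map_prod]
  split_ifs with hij
  · subst hij
    exact Finset.prod_eq_one fun k hk => (hq i k (Finset.ne_of_mem_erase hk).symm).1
  · exact Finset.prod_eq_zero (i := j) (by simp [Ne.symm hij]) (hq i j hij).2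

theorem aux_hankel_apply {K : Type*} [Field K] {n : ℕ}
    (Λ : MvPolynomial (Fin n) K →ₗ[K] K) (p q : MvPolynomial (Fin n) K) :
    hankel Λ p q = Λ (p * q) := rfl

theorem aux_mem {K : Type*} [Field K] {n : ℕ}
    (Λ : MvPolynomial (Fin n) K →ₗ[K] K) (p : MvPolynomial (Fin n) K) :
    p ∈ hankelIdeal Λ ↔ ∀ q, Λ (p * q) = 0 := Iff.rfl

theorem aux_mem_ker {K : Type*} [Field K] {n : ℕ}
    (Λ : MvPolynomial (Fin n) K →ₗ[K] K) (p : MvPolynomial (Fin n) K) :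
    hankel Λ p = 0 ↔ p ∈ hankelIdeal Λ := by
  rw [aux_mem, LinearMap.ext_iff]; rfl

theorem aux_rank {K : Type*} [Field K] {n : ℕ} {ι : Type*} [Fintype ι] [DecidableEq ι]
    (ζ : ι → (Fin n → K)) (hζ : Function.Injective ζ)
    (Λ : MvPolynomial (Fin n) K →ₗ[K] K)
    (hI : ∀ p, p ∈ hankelIdeal Λ ↔ ∀ i, eval (ζ i) p = 0) :
    Module.Finite K (LinearMap.range (hankel Λ)) ∧
      Module.finrank K (LinearMap.range (hankel Λ)) = Fintype.card ι := by
  obtain ⟨P, hP⟩ := aux_interp ζ hζ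
  let ev : MvPolynomial (Fin n) K →ₗ[K] (ι → K) :=
    LinearMap.pi fun i => (aeval (R := K) (ζ i)).toLinearMap
  have hev : ∀ p i, ev p i = eval (ζ i) p := fun p i => by
    simp [ev, aeval_eq_eval]
  have hsurj : LinearMap.range ev = ⊤ := by
    rw [LinearMap.range_eq_top]
    intro c
    refine ⟨∑ i, c i • P i, ?_⟩
    ext j
    rw [hev]
    simp [hP, smul_eval]
  have hker : LinearMap.ker (hankel Λ) = LinearMap.ker ev := by
    ext p
    rw [LinearMap.mem_ker, LinearMap.mem_ker, aux_mem_ker, hI, funext_iff]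
    simp [hev]
  let e : LinearMap.range (hankel Λ) ≃ₗ[K] (ι → K) :=
    (hankel Λ).quotKerEquivRange.symm ≪≫ₗ Submodule.quotEquivOfEq _ _ hker ≪≫ₗ
      ev.quotKerEquivRange ≪≫ₗ LinearEquiv.ofTop _ hsurj
  refine ⟨Module.Finite.equiv e.symm, ?_⟩
  rw [e.finrank_eq]; simp

theorem aux_card {K : Type*} [Field K] {n : ℕ} {ι : Type*} [Fintype ι] [DecidableEq ι]
    (ζ : ι → (Fin n → K)) (hζ : Function.Injective ζ)
    (Λ : MvPolynomial (Fin n) K →ₗ[K] K) [Module.Finite K (LinearMap.range (hankel Λ))]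
    (hI : ∀ p ∈ hankelIdeal Λ, ∀ i, eval (ζ i) p = 0) :
    Fintype.card ι ≤ Module.finrank K (LinearMap.range (hankel Λ)) := by
  obtain ⟨P, hP⟩ := aux_interp ζ hζ
  let φ : (ι → K) →ₗ[K] MvPolynomial (Fin n) K := Fintype.linearCombination K P
  have hφ : ∀ c j, eval (ζ j) (φ c) = c j := fun c j => by
    simp [φ, Fintype.linearCombination_apply, hP, smul_eval]
  have hinj : Function.Injective ((hankel Λ).rangeRestrict ∘ₗ φ) := by
    intro c c' h
    have h0 : hankel Λ (φ c) = hankel Λ (φ c') := congrArg Subtype.val h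
    have h1 : hankel Λ (φ c - φ c') = 0 := by
      rw [map_sub, h0, sub_self]
    have h2 := hI _ ((aux_mem_ker Λ _).1 h1)
    ext j
    have h3 := h2 j
    rw [map_sub, hφ, hφ, sub_eq_zero] at h3
    exact h3
  have := LinearMap.finrank_le_finrank_of_injective hinj
  simpa using this

/-- truncated moment problem: a linear functional T* on R_{≤d} is of
the form Σ γᵢ·1_{ζᵢ} with r distinct points and nonzero weights iff it extends to a
linear functional Λ on R with rank H_Λ = r and I_Λ radical. -/
theorem truncated_moment_problem {K : Type*} [Field K] [IsAlgClosed K] [CharZero K]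
    {n d r : ℕ}
    (Tstar : MvPolynomial.restrictTotalDegree (Fin n) K d →ₗ[K] K) :
    (∃ (ζ : Fin r → (Fin n → K)) (γ : Fin r → K),
        Function.Injective ζ ∧ (∀ i, γ i ≠ 0) ∧
        ∀ p : MvPolynomial.restrictTotalDegree (Fin n) K d,
          Tstar p = ∑ i, γ i * eval (ζ i) (p : MvPolynomial (Fin n) K))
    ↔
    (∃ Λ : MvPolynomial (Fin n) K →ₗ[K] K,
        (∀ p : MvPolynomial.restrictTotalDegree (Fin n) K d,
          Λ (p : MvPolynomial (Fin n) K) = Tstar p) ∧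
        Module.Finite K (LinearMap.range (hankel Λ)) ∧
        Module.finrank K (LinearMap.range (hankel Λ)) = r ∧
        (hankelIdeal Λ).IsRadical) := by
  constructor
  · rintro ⟨ζ, γ, hζ, hγ, hT⟩
    let Λ : MvPolynomial (Fin n) K →ₗ[K] K :=
      ∑ i, γ i • (aeval (R := K) (ζ i)).toLinearMap
    have hΛ : ∀ p, Λ p = ∑ i, γ i * eval (ζ i) p := fun p => by
      simp [Λ, aeval_eq_eval]
    have hI : ∀ p, p ∈ hankelIdeal Λ ↔ ∀ i, eval (ζ i) p = 0 := by
      intro p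
      rw [aux_mem]
      constructor
      · intro h i
        obtain ⟨P, hP⟩ := aux_interp ζ hζ
        have := h (P i)
        rw [hΛ] at this
        simpa [hP, hγ i] using this
      · intro h q
        rw [hΛ]
        simp [h]
    obtain ⟨h1, h2⟩ := aux_rank ζ hζ Λ hI
    refine ⟨Λ, fun p => by rw [hΛ, hT], h1, by simpa using h2, ?_⟩
    rintro p ⟨k, hk⟩
    rw [hI] at hk ⊢
    intro i
    have := hk i
    rw [map_pow] at this
    exact eq_zero_of_pow_eq_zero this
  · rintro ⟨Λ, hT, hfin, hr, hrad⟩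
    have hV : (zeroLocus K (hankelIdeal Λ)).Finite := by
      by_contra hinf
      have : Infinite (zeroLocus K (hankelIdeal Λ)) := Set.infinite_coe_iff.mpr hinf
      let f : Fin (r + 1) ↪ zeroLocus K (hankelIdeal Λ) :=
        (Fin.valEmbedding).trans (Infinite.natEmbedding _)
      have := aux_card (fun i => (f i : Fin n → K))
        (Subtype.val_injective.comp f.injective) Λ (fun p hp i => by
          have := (mem_zeroLocus_iff.1 (f i).2) p hp
          simpa [aeval_eq_eval] using this)
      rw [hr] at this
      simp at this
    have := hV.fintype
    classical
    have hI : ∀ p, p ∈ hankelIdeal Λ ↔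
        ∀ i : zeroLocus K (hankelIdeal Λ), eval (i : Fin n → K) p = 0 := by
      intro p
      conv_lhs => rw [← hrad.radical, ← vanishingIdeal_zeroLocus_eq_radical (K := K)]
      rw [mem_vanishingIdeal_iff]
      simp [aeval_eq_eval]
    have hc := (aux_rank _ Subtype.val_injective Λ hI).2
    rw [hr] at hc
    let e := (Fintype.equivFinOfCardEq hc.symm).symm
    let ζ : Fin r → (Fin n → K) := fun i => (e i : Fin n → K)
    have hζ : Function.Injective ζ := Subtype.val_injective.comp e.injective
    have hI' : ∀ p, p ∈ hankelIdeal Λ ↔ ∀ i, eval (ζ i) p = 0 := by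
      intro p
      rw [hI]
      refine ⟨fun h i => h (e i), fun h i => ?_⟩
      have := h (e.symm i)
      simpa [ζ] using this
    obtain ⟨P, hP⟩ := aux_interp ζ hζ
    have hΛ : ∀ p, Λ p = ∑ i, Λ (P i) * eval (ζ i) p := by
      intro p
      have h1 : p - ∑ i, eval (ζ i) p • P i ∈ hankelIdeal Λ := by
        rw [hI']
        intro j
        simp [hP, smul_eval]
      have h2 := (aux_mem _ _).1 h1 1
      rw [mul_one, map_sub, sub_eq_zero] at h2
      rw [h2, map_sum]
      simp [mul_comm]
    refine ⟨ζ, fun i => Λ (P i), hζ, fun i h0 => ?_, fun p => by rw [← hT, hΛ]⟩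
    have : P i ∈ hankelIdeal Λ := by
      rw [aux_mem]
      intro q
      rw [hΛ]
      simp [hP, h0]
    have := (hI' _).1 this i
    simp [hP] at this
end
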